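/- Let Γ be an inverse semigroup with zero (not necessarily satisfying condition (L)), and let p, p₁, …, pₙ ∈ Γ⁽⁰⁾ be idempotents. Then the following are equivalent: (i) p < (p₁,…,pₙ); (ii) for every maximal zero-free directed set B ⊆ Γ (i.e. B directed, 0 ∉ B, and the only directed set C with B ⊆ C and 0 ∉ C is B itself) such that some b ∈ B satisfies b ≺ p, there exist j ∈ {1,…,n} and b' ∈ B with b' ≺ p_j. -/

import Mathlib

/-- An inverse semigroup: a semigroup in which every element `x` has a unique
element `x⁻¹` with `x * x⁻¹ * x = x` and `x⁻¹ * x * x⁻¹ = x⁻¹`. -/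
class InverseSemigroup (α : Type*) extends Semigroup α, Inv α where
  mul_inv_mul : ∀ x : α, x * x⁻¹ * x = x
  inv_mul_inv : ∀ x : α, x⁻¹ * x * x⁻¹ = x⁻¹
  inv_unique : ∀ x y : α, x * y * x = x → y * x * y = y → y = x⁻¹

variable {α : Type*} [InverseSemigroup α]

/-- The natural order on an inverse semigroup: `x ≺ y` iff `x * y⁻¹ = x * x⁻¹`. -/
def prec (x y : α) : Prop := x * y⁻¹ = x * x⁻¹

/-- The idempotents (units) `Γ⁽⁰⁾`: elements `p` with `p = p * p⁻¹`. -/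
def IsIdem (p : α) : Prop := p = p * p⁻¹

/-- A zero element: `z * x = z = x * z` for every `x`. -/
def IsZeroEl (z : α) : Prop := ∀ x : α, z * x = z ∧ x * z = z


/-- A subset A is directed if any two of its elements have a common
precessor in A. -/
def IsDirectedSet (A : Set α) : Prop :=
  ∀ a ∈ A, ∀ b ∈ A, ∃ c ∈ A, prec c a ∧ prec c b

/-- Elementwise product of two subsets. -/
def mulSet (A B : Set α) : Set α := {x | ∃ a ∈ A, ∃ b ∈ B, x = a * b}

/-- Elementwise inverse of a subset. -/
def invSet (A : Set α) : Set α := {x | ∃ a ∈ A, x = a⁻¹}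

/-- A ≼ B iff every b ∈ B has some a ∈ A with a ≺ b. -/
def sprec (A B : Set α) : Prop := ∀ b ∈ B, ∃ a ∈ A, prec a b

/-- A ∼ B iff A ≼ B and B ≼ A. -/
def sequiv (A B : Set α) : Prop := sprec A B ∧ sprec B A


/-- The relation x < (x₁,…,xₙ) (w.r.t. the zero z0), with the finite family
given as a finset: every nonzero precessor of x has a nonzero common precessor
with some member of s. -/
def ltS (z0 x : α) (s : Finset α) : Prop :=
  ∀ y : α, prec y x → y ≠ z0 → ∃ t ∈ s, ∃ w : α, w ≠ z0 ∧ prec w y ∧ prec w t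


/-- A maximal zero-free directed set: directed, avoiding the zero, and maximal
among directed sets avoiding the zero. -/
def MaxZeroFree (z0 : α) (B : Set α) : Prop :=
  IsDirectedSet B ∧ z0 ∉ B ∧
    ∀ C : Set α, IsDirectedSet C → B ⊆ C → z0 ∉ C → C = B


namespace InverseSemigroup

theorem inv_inv_eq (x : α) : x⁻¹⁻¹ = x :=
  (inv_unique x⁻¹ x (inv_mul_inv x) (mul_inv_mul x)).symm

theorem inv_eq_self {e : α} (he : e * e = e) : e⁻¹ = e :=
  (inv_unique e e (by rw [he, he]) (by rw [he, he])).symm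

theorem mul_idem {e f : α} (he : e * e = e) (hf : f * f = f) : e * f * (e * f) = e * f := by
  have h1 := mul_inv_mul (e * f)
  have h2 := inv_mul_inv (e * f)
  have h3 := inv_unique (e * f) (f * (e * f)⁻¹ * e)
  have h4 := inv_inv_eq (e * f)
  generalize (e * f)⁻¹ = x at *
  have hx : f * x * e = x := by
    apply h3
    · calc e * f * (f * x * e) * (e * f) = e * (f * f) * x * (e * e) * f := by
            simp only [mul_assoc]
        _ = e * f := by rw [he, hf, mul_assoc (e * f * x), h1]
    · calc f * x * e * (e * f) * (f * x * e) = f * x * (e * e) * (f * f) * x * e := by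
            simp only [mul_assoc]
        _ = f * (x * (e * f) * x) * e := by rw [he, hf]; simp only [mul_assoc]
        _ = f * x * e := by rw [h2]
  have hxx : x * x = x := by
    calc x * x = f * x * e * (f * x * e) := by rw [hx]
      _ = f * (x * (e * f) * x) * e := by simp only [mul_assoc]
      _ = x := by rw [h2, hx]
  rw [inv_eq_self hxx] at h4
  rw [← h4, hxx]

theorem idem_comm {e f : α} (he : e * e = e) (hf : f * f = f) : e * f = f * e := by
  have h1 := mul_idem he hf
  have h2 := mul_idem hf he
  have h : f * e = (e * f)⁻¹ := by
    apply inv_unique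
    · calc e * f * (f * e) * (e * f) = e * (f * f) * (e * e) * f := by simp only [mul_assoc]
        _ = e * f := by rw [he, hf, mul_assoc (e * f), h1]
    · calc f * e * (e * f) * (f * e) = f * (e * e) * (f * f) * e := by simp only [mul_assoc]
        _ = f * e := by rw [he, hf, mul_assoc (f * e), h2]
  rw [h, inv_eq_self h1]

theorem mul_inv_idem (x : α) : x * x⁻¹ * (x * x⁻¹) = x * x⁻¹ := by
  rw [← mul_assoc, mul_inv_mul]

theorem inv_mul_idem (x : α) : x⁻¹ * x * (x⁻¹ * x) = x⁻¹ * x := by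
  rw [← mul_assoc, inv_mul_inv]

theorem mul_inv_rev_eq (x y : α) : (x * y)⁻¹ = y⁻¹ * x⁻¹ := by
  have hc := idem_comm (mul_inv_idem y) (inv_mul_idem x)
  symm
  apply inv_unique
  · calc x * y * (y⁻¹ * x⁻¹) * (x * y) = x * (y * y⁻¹ * (x⁻¹ * x)) * y := by
          simp only [mul_assoc]
      _ = x * x⁻¹ * x * (y * y⁻¹ * y) := by rw [hc]; simp only [mul_assoc]
      _ = x * y := by rw [mul_inv_mul, mul_inv_mul]
  · calc y⁻¹ * x⁻¹ * (x * y) * (y⁻¹ * x⁻¹) = y⁻¹ * (x⁻¹ * x * (y * y⁻¹)) * x⁻¹ := by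
          simp only [mul_assoc]
      _ = y⁻¹ * y * y⁻¹ * (x⁻¹ * x * x⁻¹) := by rw [← hc]; simp only [mul_assoc]
      _ = y⁻¹ * x⁻¹ := by rw [inv_mul_inv, inv_mul_inv]

theorem prec_iff {x y : α} : prec x y ↔ ∃ e : α, e * e = e ∧ x = y * e := by
  constructor
  · intro h
    refine ⟨x⁻¹ * x, inv_mul_idem x, ?_⟩
    have h' := congrArg (·⁻¹) (show x * y⁻¹ = x * x⁻¹ from h)
    simp only [mul_inv_rev_eq, inv_inv_eq] at h'
    rw [← mul_assoc, h', mul_inv_mul]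
  · rintro ⟨e, he, rfl⟩
    unfold prec
    rw [mul_inv_rev_eq, inv_eq_self he, ← mul_assoc (y * e), mul_assoc y e e, he]

theorem prec_refl (x : α) : prec x x := rfl

theorem prec_mul_right (x : α) {e : α} (he : e * e = e) : prec (x * e) x :=
  prec_iff.2 ⟨e, he, rfl⟩

theorem prec_trans {x y z : α} (hxy : prec x y) (hyz : prec y z) : prec x z := by
  obtain ⟨e, he, rfl⟩ := prec_iff.1 hxy
  obtain ⟨f, hf, rfl⟩ := prec_iff.1 hyz
  exact prec_iff.2 ⟨f * e, mul_idem hf he, mul_assoc z f e⟩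

theorem prec_mul_mul {x y e : α} (h : prec x y) (he : e * e = e) : prec (x * e) (y * e) := by
  obtain ⟨f, hf, rfl⟩ := prec_iff.1 h
  exact prec_iff.2 ⟨f, hf, by rw [mul_assoc, mul_assoc, idem_comm he hf]⟩

theorem idem_of_prec {x e : α} (he : e * e = e) (h : prec x e) : x * x = x := by
  obtain ⟨f, hf, rfl⟩ := prec_iff.1 h
  exact mul_idem he hf

theorem mul_eq_of_prec {x e : α} (he : e * e = e) (h : prec x e) : x * e = x := by
  obtain ⟨f, hf, rfl⟩ := prec_iff.1 h
  rw [mul_assoc, ← idem_comm he hf, ← mul_assoc, he]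

theorem eq_zero_of_prec {z0 x : α} (hz : IsZeroEl z0) (h : prec x z0) : x = z0 := by
  obtain ⟨e, -, rfl⟩ := prec_iff.1 h
  exact (hz e).1

theorem idem_of_isIdem {p : α} (hp : IsIdem p) : p * p = p := by
  have h := mul_inv_idem p
  rwa [← hp] at h

theorem exists_lower_bound {B : Set α} (hB : IsDirectedSet B) {b : α} (hb : b ∈ B)
    (f : α → α) (s : Finset α) (hf : ∀ t ∈ s, f t ∈ B) :
    ∃ c ∈ B, prec c b ∧ ∀ t ∈ s, prec c (f t) := by
  classical
  induction s using Finset.induction_on with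
  | empty => exact ⟨b, hb, prec_refl b, by simp⟩
  | insert a s _ ih =>
    obtain ⟨c, hc, hcb, hcs⟩ := ih fun t ht => hf t (Finset.mem_insert_of_mem ht)
    obtain ⟨d, hd, hdc, hda⟩ := hB c hc (f a) (hf a (Finset.mem_insert_self a s))
    refine ⟨d, hd, prec_trans hdc hcb, fun t ht => ?_⟩
    rcases Finset.mem_insert.1 ht with rfl | ht
    · exact hda
    · exact prec_trans hdc (hcs t ht)

/-- A maximal zero-free directed set is closed under right multiplication by an idempotent that
annihilates none of its elements. -/
theorem _root_.MaxZeroFree.mul_mem {z0 : α} {B : Set α} (hB : MaxZeroFree z0 B) {t : α}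
    (ht : t * t = t) (h : ∀ c ∈ B, c * t ≠ z0) {b : α} (hb : b ∈ B) : b * t ∈ B := by
  obtain ⟨hdir, h0, hmax⟩ := hB
  have key : B ∪ Set.image (· * t) B = B := by
    refine hmax _ ?_ Set.subset_union_left ?_
    · have bound : ∀ a ∈ B ∪ Set.image (· * t) B, ∃ c ∈ B, prec (c * t) a := by
        rintro a (ha | ⟨c, hc, rfl⟩)
        · exact ⟨a, ha, prec_mul_right a ht⟩
        · exact ⟨c, hc, prec_refl _⟩
      intro a ha a' ha'
      obtain ⟨c, hc, hca⟩ := bound a ha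
      obtain ⟨c', hc', hca'⟩ := bound a' ha'
      obtain ⟨d, hd, hdc, hdc'⟩ := hdir c hc c' hc'
      exact ⟨d * t, Or.inr ⟨d, hd, rfl⟩, prec_trans (prec_mul_mul hdc ht) hca,
        prec_trans (prec_mul_mul hdc' ht) hca'⟩
    · rintro (h' | ⟨c, hc, hct⟩)
      · exact h0 h'
      · exact h c hc hct
  rw [← key]
  exact Or.inr ⟨b, hb, rfl⟩

theorem exists_maxZeroFree_mem {z0 y : α} (hy : y ≠ z0) : ∃ B, MaxZeroFree z0 B ∧ y ∈ B := by
  obtain ⟨B, hyB, hB⟩ := zorn_subset_nonempty {A : Set α | IsDirectedSet A ∧ z0 ∉ A} (by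
    intro c hc hchain _
    refine ⟨⋃₀ c, ⟨?_, ?_⟩, fun A hA => Set.subset_sUnion_of_mem hA⟩
    · rintro a ⟨A, hA, ha⟩ b ⟨A', hA', hb⟩
      obtain ⟨D, hD, hAD, hAD'⟩ := hchain.directedOn A hA A' hA'
      obtain ⟨d, hd, hda, hdb⟩ := (hc hD).1 a (hAD ha) b (hAD' hb)
      exact ⟨d, ⟨D, hD, hd⟩, hda, hdb⟩
    · rintro ⟨A, hA, h0⟩
      exact (hc hA).2 h0) {y} ⟨by
        rintro a rfl b rfl
        exact ⟨_, rfl, prec_refl _, prec_refl _⟩, fun h => hy h.symm⟩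
  exact ⟨B, ⟨hB.prop.1, hB.prop.2, fun C hC hBC h0 => (hB.eq_of_subset ⟨hC, h0⟩ hBC).symm⟩,
    hyB rfl⟩

end InverseSemigroup

open InverseSemigroup in
/-- for arbitrary Γ with zero (no condition (L)) and idempotents
p, p₁,…,pₙ, one has p < (p₁,…,pₙ) iff every maximal zero-free directed set B
meeting {b : b ≺ p} meets {b : b ≺ pⱼ} for some j. -/
theorem stmt18 {z0 : α} (hz : IsZeroEl z0)
    {p : α} (hp : IsIdem p) {s : Finset α} (hs : ∀ q ∈ s, IsIdem q) :
    ltS z0 p s ↔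
      ∀ B : Set α, MaxZeroFree z0 B → (∃ b ∈ B, prec b p) →
        ∃ t ∈ s, ∃ b ∈ B, prec b t := by
  constructor
  · rintro h B hB ⟨b, hb, hbp⟩
    by_contra! hn
    have hann : ∀ t ∈ s, ∃ c ∈ B, c * t = z0 := by
      intro t ht
      have htt := idem_of_isIdem (hs t ht)
      have hbb := idem_of_prec (idem_of_isIdem hp) hbp
      by_contra! hc
      refine hn t ht (b * t) (hB.mul_mem htt hc hb) ?_
      rw [idem_comm hbb htt]
      exact prec_mul_right t hbb
    choose! f hfB hf using hann
    obtain ⟨c, hc, hcb, hcf⟩ := exists_lower_bound hB.1 hb f s hfB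
    obtain ⟨t, ht, w, hw, hwc, hwt⟩ :=
      h c (prec_trans hcb hbp) fun h0 => hB.2.1 (h0 ▸ hc)
    have htt := idem_of_isIdem (hs t ht)
    have hwz := prec_mul_mul (prec_trans hwc (hcf t ht)) htt
    rw [mul_eq_of_prec htt hwt, hf t ht] at hwz
    exact hw (eq_zero_of_prec hz hwz)
  · intro h y hyp hy
    obtain ⟨B, hB, hyB⟩ := exists_maxZeroFree_mem hy
    obtain ⟨t, ht, b, hb, hbt⟩ := h B hB ⟨y, hyB, hyp⟩
    obtain ⟨c, hc, hcy, hcb⟩ := hB.1 y hyB b hb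
    exact ⟨t, ht, c, fun h0 => hB.2.1 (h0 ▸ hc), hcy, prec_trans hcb hbt⟩
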